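/- Let M be a free ℤ-module of finite rank equipped with a symmetric ℤ-bilinear form B that is nondegenerate (i.e. B(x, y) = 0 for all y implies x = 0), and let φ : M → ℚ/ℤ be an additive group homomorphism. Let N = ker φ, regarded as a submodule of M, and suppose there exists a ℤ-linear isomorphism f : N → M satisfying B(f x, f y) = B(x, y) for all x, y ∈ N. Then φ = 0. -/

import Mathlib

open LinearMap in
/-- An endomorphism preserving a nondegenerate bilinear form on a finite free module over a domain
is bijective, because its determinant squares to `1`. -/
theorem LinearMap.isUnit_of_isometry {R M : Type*} [CommRing R] [IsDomain R] [AddCommGroup M]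
    [Module R M] [Module.Free R M] [Module.Finite R M] {B : M →ₗ[R] M →ₗ[R] R}
    (hB : B.SeparatingLeft) {g : M →ₗ[R] M} (hg : ∀ x y, B (g x) (g y) = B x y) :
    IsUnit g := by
  classical
  let b := Module.Free.chooseBasis R M
  have hcomp : B.compl₁₂ g g = B := by
    ext x y
    exact hg x y
  have hdet : (toMatrix₂ b b B).det ≠ 0 :=
    (separatingLeft_iff_det_ne_zero b).mp hB
  have h := congrArg Matrix.det (toMatrix₂_compl₁₂ b b b b B g g)
  rw [hcomp, Matrix.det_mul, Matrix.det_mul, Matrix.det_transpose, det_toMatrix] at h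
  have hsq : LinearMap.det g * LinearMap.det g = 1 :=
    mul_right_cancel₀ hdet (by linear_combination -h)
  exact (isUnit_iff_isUnit_det g).mpr (IsUnit.of_mul_eq_one _ hsq)

/-- If the kernel of an additive homomorphism `φ : M → ℚ/ℤ` on a nondegenerate
integral lattice `M`, regarded as a submodule `N ⊆ M`, is isometric to `M`
itself, then `φ = 0`. -/
theorem stmt_6 (M : Type*) [AddCommGroup M] [Module ℤ M]
    [Module.Free ℤ M] [Module.Finite ℤ M]
    (B : M →ₗ[ℤ] M →ₗ[ℤ] ℤ) (hsymm : ∀ x y, B x y = B y x)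
    (hnd : ∀ x, (∀ y, B x y = 0) → x = 0)
    (φ : M →+ AddCircle (1 : ℚ))
    (N : Submodule ℤ M) (hN : ∀ x : M, x ∈ N ↔ x ∈ φ.ker)
    (f : N ≃ₗ[ℤ] M) (hf : ∀ x y : N, B (f x) (f y) = B (x : M) (y : M)) :
    φ = 0 := by
  let g : M →ₗ[ℤ] M :=
    { toFun := fun x ↦ f.symm x
      map_add' := fun x y ↦ by simp
      map_smul' := fun c x ↦
        map_intCast_smul (N.toAddSubgroup.subtype.comp (f.symm : M →+ N)) ℤ ℤ c x }
  have hg : IsUnit g :=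
    LinearMap.isUnit_of_isometry hnd fun x y ↦
      (hf (f.symm x) (f.symm y)).symm.trans (by simp)
  ext x
  obtain ⟨y, rfl⟩ := ((Module.End.isUnit_iff _).mp hg).surjective x
  exact (hN _).mp (f.symm y).2
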